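/- Uniform Gronwall Lemma: Let g, h, y be three non-negative locally integrable functions on (t₀, +∞) such that y is differentiable on (t₀,+∞) with y'(t) ≤ g(t)·y(t) + h(t) for all t ≥ t₀, and suppose there exist positive constants r, a₁, a₂, a₃ such that for every t ≥ t₀ one has ∫ₜ^{t+r} g(s) ds ≤ a₁, ∫ₜ^{t+r} h(s) ds ≤ a₂, and ∫ₜ^{t+r} y(s) ds ≤ a₃. Then y(t + r) ≤ (a₃/r + a₂)·e^{a₁} for all t ≥ t₀. -/

import Mathlib

open MeasureTheory intervalIntegral

/-- Postcomposition with a Lipschitz function preserves absolute continuity. -/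
theorem LipschitzOnWith.comp_absolutelyContinuousOnInterval {X Y : Type*} [PseudoMetricSpace X]
    [PseudoMetricSpace Y] {K : NNReal} {φ : X → Y} {s : Set X} {f : ℝ → X} {a b : ℝ}
    (hφ : LipschitzOnWith K φ s) (hf : AbsolutelyContinuousOnInterval f a b)
    (hs : Set.MapsTo f (Set.uIcc a b) s) :
    AbsolutelyContinuousOnInterval (φ ∘ f) a b := by
  have hf' : Filter.Tendsto _ _ _ := hf
  refine squeeze_zero' (.of_forall fun E ↦ Finset.sum_nonneg fun i _ ↦ dist_nonneg) ?_
    (by simpa using hf'.const_mul (K : ℝ))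
  refine Filter.eventually_inf_principal.2 (.of_forall fun E hE ↦ ?_)
  rw [Finset.mul_sum]
  exact Finset.sum_le_sum fun i hi ↦
    hφ.dist_le_mul _ (hs (hE.1 i hi).1) _ (hs (hE.1 i hi).2)

/-- **Grönwall's inequality**, integral form, with an integrable kernel. -/
theorem le_mul_exp_integral_of_le_add_integral {g y : ℝ → ℝ} {a b C : ℝ} (hab : a ≤ b)
    (hg0 : ∀ x ∈ Set.Icc a b, 0 ≤ g x) (hg : IntervalIntegrable g volume a b)
    (hgy : IntervalIntegrable (fun x ↦ g x * y x) volume a b)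
    (hle : ∀ x ∈ Set.Icc a b, y x ≤ C + ∫ s in a..x, g s * y s) :
    y b ≤ C * Real.exp (∫ s in a..b, g s) := by
  set u : ℝ → ℝ := fun x ↦ ∫ s in a..x, g s * y s
  set G : ℝ → ℝ := fun x ↦ ∫ s in a..x, g s
  have hu : AbsolutelyContinuousOnInterval u a b :=
    hgy.absolutelyContinuousOnInterval_intervalIntegral Set.left_mem_uIcc
  have hG : AbsolutelyContinuousOnInterval G a b :=
    hg.absolutelyContinuousOnInterval_intervalIntegral Set.left_mem_uIcc
  have hCu : AbsolutelyContinuousOnInterval (fun x ↦ C + u x) a b :=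
    (contDiff_const (c := C)).contDiffOn.absolutelyContinuousOnInterval.add hu
  have hE : AbsolutelyContinuousOnInterval (fun x ↦ Real.exp (-G x)) a b := by
    obtain ⟨M, hM⟩ := hG.exists_bound
    obtain ⟨K, hK⟩ := (Real.contDiff_exp (n := 1)).contDiffOn.exists_lipschitzOnWith
      (s := Set.Icc (-M) M) (by decide) (convex_Icc _ _) isCompact_Icc
    refine hK.comp_absolutelyContinuousOnInterval hG.neg fun x hx ↦ ?_
    have := abs_le.1 (hM x hx)
    exact ⟨by simpa using this.2, by simpa using neg_le.1 this.1⟩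
  have key := (hCu.fun_mul hE).integral_deriv_eq_sub
  have hnonpos : ∫ x in a..b, deriv (fun x ↦ (C + u x) * Real.exp (-G x)) x ≤ 0 := by
    rw [← neg_nonneg, ← intervalIntegral.integral_neg]
    refine intervalIntegral.integral_nonneg_of_ae_restrict hab ?_
    refine (ae_restrict_iff' measurableSet_Icc).2 ?_
    filter_upwards [hgy.ae_hasDerivAt_integral, hg.ae_hasDerivAt_integral] with x hx₁ hx₂ hx
    have hx' : x ∈ Set.uIcc a b := by rwa [Set.uIcc_of_le hab]
    have h₁ : HasDerivAt u (g x * y x) x := hx₁ hx' a Set.left_mem_uIcc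
    have h₂ : HasDerivAt G (g x) x := hx₂ hx' a Set.left_mem_uIcc
    have h₃ := ((h₁.const_add C).mul h₂.neg.exp).deriv
    have h₄ := mul_nonneg (mul_nonneg (hg0 x hx) (sub_nonneg.2 (hle x hx))) (Real.exp_pos (-G x)).le
    have h₅ : deriv (fun x ↦ (C + u x) * Real.exp (-G x)) x = _ := h₃
    simp only [Pi.zero_apply, Pi.neg_apply] at h₅ ⊢
    rw [h₅]
    linarith
  rw [key] at hnonpos
  have hua : u a = 0 := intervalIntegral.integral_same
  have hGa : G a = 0 := intervalIntegral.integral_same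
  simp only [hua, hGa, add_zero, neg_zero, Real.exp_zero, mul_one, Real.exp_neg] at hnonpos
  calc y b ≤ C + u b := hle b (Set.right_mem_Icc.2 hab)
    _ ≤ C * Real.exp (G b) := by
      rwa [sub_nonpos, mul_inv_le_iff₀ (Real.exp_pos _)] at hnonpos

/-- **Grönwall's inequality**, with integrable coefficients. -/
theorem le_add_integral_mul_exp_integral_of_deriv_le {g h y y' : ℝ → ℝ} {a b : ℝ} (hab : a ≤ b)
    (hg0 : ∀ x ∈ Set.Icc a b, 0 ≤ g x) (hh0 : ∀ x ∈ Set.Icc a b, 0 ≤ h x)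
    (hg : IntervalIntegrable g volume a b) (hh : IntervalIntegrable h volume a b)
    (hderiv : ∀ x ∈ Set.Icc a b, HasDerivAt y (y' x) x)
    (hineq : ∀ x ∈ Set.Icc a b, y' x ≤ g x * y x + h x) :
    y b ≤ (y a + ∫ s in a..b, h s) * Real.exp (∫ s in a..b, g s) := by
  have hcont : ContinuousOn y (Set.Icc a b) := fun x hx ↦
    (hderiv x hx).continuousAt.continuousWithinAt
  have hgy : IntervalIntegrable (fun x ↦ g x * y x) volume a b :=
    hg.mul_continuousOn (by rwa [Set.uIcc_of_le hab])
  refine le_mul_exp_integral_of_le_add_integral hab hg0 hg hgy fun x hx ↦ ?_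
  have hsub : Set.Icc a x ⊆ Set.Icc a b := Set.Icc_subset_Icc_right hx.2
  have hsub' : Set.uIcc a x ⊆ Set.uIcc a b := by
    rwa [Set.uIcc_of_le hab, Set.uIcc_of_le hx.1]
  have h₁ := sub_le_integral_of_hasDeriv_right_of_le hx.1 (hcont.mono hsub)
    (fun z hz ↦ (hderiv z (hsub (Set.Ioo_subset_Icc_self hz))).hasDerivWithinAt)
    ((intervalIntegrable_iff_integrableOn_Icc_of_le hx.1).1
      ((hgy.add hh).mono_set hsub'))
    (fun z hz ↦ hineq z (hsub (Set.Ioo_subset_Icc_self hz)))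
  rw [intervalIntegral.integral_add (hgy.mono_set hsub') (hh.mono_set hsub')] at h₁
  have h₂ : ∫ s in a..x, h s ≤ ∫ s in a..b, h s :=
    intervalIntegral.integral_mono_interval le_rfl hx.1 hx.2
      ((ae_restrict_iff' measurableSet_Ioc).2 (.of_forall fun z hz ↦
        hh0 z (Set.Ioc_subset_Icc_self hz))) hh
  linarith

/-- **Uniform Gronwall Lemma.** If `y' ≤ g y + h` with `g, h, y` non-negative and
locally integrable on `(t₀, ∞)`, `y` differentiable on `(t₀, ∞)`, and the integrals of
`g`, `h`, `y` over every window `[t, t + r]` with `t ≥ t₀` are bounded by `a₁`, `a₂`, `a₃`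
respectively, then `y (t + r) ≤ (a₃ / r + a₂) * exp a₁` for every `t ≥ t₀`. -/
theorem uniform_gronwall (t₀ r a₁ a₂ a₃ : ℝ) (g h y y' : ℝ → ℝ)
    (hr : 0 < r) (ha₁ : 0 < a₁) (ha₂ : 0 < a₂) (ha₃ : 0 < a₃)
    (hg0 : ∀ t ∈ Set.Ioi t₀, 0 ≤ g t) (hh0 : ∀ t ∈ Set.Ioi t₀, 0 ≤ h t)
    (hy0 : ∀ t ∈ Set.Ioi t₀, 0 ≤ y t)
    (hgloc : LocallyIntegrableOn g (Set.Ioi t₀))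
    (hhloc : LocallyIntegrableOn h (Set.Ioi t₀))
    (hyloc : LocallyIntegrableOn y (Set.Ioi t₀))
    (hderiv : ∀ t ∈ Set.Ioi t₀, HasDerivAt y (y' t) t)
    (hineq : ∀ t, t₀ ≤ t → y' t ≤ g t * y t + h t)
    (hgint : ∀ t, t₀ ≤ t → (∫ s in t..(t + r), g s) ≤ a₁)
    (hhint : ∀ t, t₀ ≤ t → (∫ s in t..(t + r), h s) ≤ a₂)
    (hyint : ∀ t, t₀ ≤ t → (∫ s in t..(t + r), y s) ≤ a₃) :
    ∀ t, t₀ ≤ t → y (t + r) ≤ (a₃ / r + a₂) * Real.exp a₁ := by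
  have hinterior : ∀ t, t₀ < t → y (t + r) ≤ (a₃ / r + a₂) * Real.exp a₁ := by
    intro t ht
    have htr : t ≤ t + r := by linarith
    have hpos : ∀ {x}, x ∈ Set.Icc t (t + r) → x ∈ Set.Ioi t₀ := fun hx ↦ ht.trans_le hx.1
    have hint : ∀ {f : ℝ → ℝ}, LocallyIntegrableOn f (Set.Ioi t₀) →
        IntervalIntegrable f volume t (t + r) := fun hf ↦
      (intervalIntegrable_iff_integrableOn_Icc_of_le htr).2
        (hf.integrableOn_compact_subset (fun _ ↦ hpos) isCompact_Icc)
    have hpoint : ∀ s ∈ Set.Icc t (t + r), y (t + r) ≤ (y s + a₂) * Real.exp a₁ := by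
      intro s hs
      have hsub : Set.Icc s (t + r) ⊆ Set.Icc t (t + r) := Set.Icc_subset_Icc_left hs.1
      have hsub' : Set.uIcc s (t + r) ⊆ Set.uIcc t (t + r) := by
        rwa [Set.uIcc_of_le htr, Set.uIcc_of_le hs.2]
      have hmono : ∀ {f : ℝ → ℝ}, (∀ x ∈ Set.Ioi t₀, 0 ≤ f x) →
          LocallyIntegrableOn f (Set.Ioi t₀) →
          ∫ x in s..(t + r), f x ≤ ∫ x in t..(t + r), f x := fun hf0 hf ↦
        intervalIntegral.integral_mono_interval hs.1 hs.2 le_rfl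
          ((ae_restrict_iff' measurableSet_Ioc).2 (.of_forall fun z hz ↦
            hf0 z (hpos (Set.Ioc_subset_Icc_self hz)))) (hint hf)
      have hys := hy0 s (hpos hs)
      calc y (t + r)
          ≤ (y s + ∫ x in s..(t + r), h x) * Real.exp (∫ x in s..(t + r), g x) :=
            le_add_integral_mul_exp_integral_of_deriv_le hs.2
              (fun x hx ↦ hg0 x (hpos (hsub hx))) (fun x hx ↦ hh0 x (hpos (hsub hx)))
              ((hint hgloc).mono_set hsub') ((hint hhloc).mono_set hsub')
              (fun x hx ↦ hderiv x (hpos (hsub hx)))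
              (fun x hx ↦ hineq x (hpos (hsub hx)).le)
        _ ≤ (y s + a₂) * Real.exp a₁ := by
            gcongr
            · exact (hmono hh0 hhloc).trans (hhint t ht.le)
            · exact (hmono hg0 hgloc).trans (hgint t ht.le)
    have hmean := intervalIntegral.integral_mono_on htr intervalIntegrable_const
      (((hint hyloc).add intervalIntegrable_const).mul_const (Real.exp a₁)) hpoint
    rw [intervalIntegral.integral_mul_const,
      intervalIntegral.integral_add (hint hyloc) intervalIntegrable_const] at hmean
    simp only [intervalIntegral.integral_const, add_sub_cancel_left, smul_eq_mul] at hmean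
    refine le_of_mul_le_mul_left ?_ hr
    calc r * y (t + r) ≤ _ := hmean
      _ ≤ (a₃ + r * a₂) * Real.exp a₁ := by
          gcongr
          exact hyint t ht.le
      _ = r * ((a₃ / r + a₂) * Real.exp a₁) := by field_simp
  intro t ht
  have hcont : ContinuousAt (fun s ↦ y (s + r)) t :=
    ContinuousAt.comp (f := fun s ↦ s + r)
      (hderiv (t + r) (show t₀ < t + r by linarith)).continuousAt (by fun_prop)
  refine le_of_tendsto (hcont.mono_left (nhdsWithin_le_nhds (s := Set.Ioi t))) ?_
  filter_upwards [self_mem_nhdsWithin] with s hs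
  exact hinterior s (ht.trans_lt hs)
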